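/- Let G be an isometric multiple HNN extension of a finitely presented base group (A,X) with stable letters s_1,…,s_n. Then the natural inclusion of A into G is an isometric embedding of word metrics: for every element a ∈ A, the word length of a in G with respect to X ∪ {s_1,…,s_n} equals the word length of a in A with respect to X. In particular, the metric sphere (resp. ball) of radius N in (A,X) is a subset of the metric sphere (resp. ball) of radius N in (G, X ∪ {s_1,…,s_n}). -/

import Mathlib

/-!  Common framework: words over an inverse-closed generating set, word length,
geodesics, falsification by fellow traveler property, almost convexity. -/

namespace ACPaper

section Core

variable {β G : Type*} [Group G]

/-- A letter is a generator (`Sum.inl`) or the formal inverse of a generator (`Sum.inr`);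
this realizes the inverse-closed alphabet `X^{±1}`. -/
def letterEval (gen : β → G) : β ⊕ β → G :=
  Sum.elim gen fun b => (gen b)⁻¹

/-- Evaluation of a word over `X^{±1}` in the group. -/
def eval (gen : β → G) (w : List (β ⊕ β)) : G :=
  (w.map (letterEval gen)).prod

/-- `gen` is a generating set: every element is represented by some word. -/
def Generates (gen : β → G) : Prop :=
  ∀ g : G, ∃ w : List (β ⊕ β), eval gen w = g

/-- Word length of a group element with respect to the generating set. -/
noncomputable def wlen (gen : β → G) (g : G) : ℕ :=
  sInf {n : ℕ | ∃ w : List (β ⊕ β), eval gen w = g ∧ w.length = n}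

/-- A word is geodesic if its length equals the word length of the element it represents. -/
def IsGeodesic (gen : β → G) (w : List (β ⊕ β)) : Prop :=
  w.length = wlen gen (eval gen w)

/-- The point reached after `t` steps along the unit-speed path labelled by `w`
(the path remains at its endpoint after time `w.length`). -/
def pos (gen : β → G) (w : List (β ⊕ β)) (t : ℕ) : G :=
  eval gen (w.take t)

/-- Synchronous falsification by fellow traveler property with constant `k`:
every non-geodesic word is synchronously `k`-fellow traveled by a shorter word
representing the same element. -/
def SynchFFTP (gen : β → G) (k : ℕ) : Prop :=
  ∀ w : List (β ⊕ β), ¬ IsGeodesic gen w →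
    ∃ w' : List (β ⊕ β), eval gen w' = eval gen w ∧ w'.length < w.length ∧
      ∀ t : ℕ, wlen gen ((pos gen w t)⁻¹ * pos gen w' t) ≤ k

/-- The path starting at `g` labelled by the word `w` stays in the ball of radius `N`
about the identity. -/
def PathInBall (gen : β → G) (N : ℕ) (g : G) (w : List (β ⊕ β)) : Prop :=
  ∀ t : ℕ, wlen gen (g * pos gen w t) ≤ N

/-- Almost convexity with constant `C`: any two elements of the sphere of radius `N ≥ 1`
at distance at most `2` are joined by a path of length at most `C` inside the ball of
radius `N`. -/
def AlmostConvexWith (gen : β → G) (C : ℕ) : Prop :=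
  ∀ N : ℕ, 1 ≤ N → ∀ g g' : G, wlen gen g = N → wlen gen g' = N →
    wlen gen (g⁻¹ * g') ≤ 2 →
    ∃ w : List (β ⊕ β), g * eval gen w = g' ∧ w.length ≤ C ∧ PathInBall gen N g w

/-- Almost convexity: almost convex with some positive constant. -/
def AlmostConvex (gen : β → G) : Prop :=
  ∃ C : ℕ, 0 < C ∧ AlmostConvexWith gen C


end Core

/-- Two letters are an inverse pair (`x` followed by `x⁻¹`, or `x⁻¹` followed by `x`). -/
def IsInvPair {β : Type*} : β ⊕ β → β ⊕ β → Prop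
  | Sum.inl x, Sum.inr y => x = y
  | Sum.inr x, Sum.inl y => x = y
  | _, _ => False

/-- A word over a formal alphabet `κ^{±1}` is freely reduced. -/
def FreelyReduced {κ : Type*} (l : List (κ ⊕ κ)) : Prop :=
  l.Chain' fun a b => ¬ IsInvPair a b

/-- Every geodesic word (over `X^{±1}`) representing an element of the subgroup generated
by `gens` is a concatenation of geodesic words, each representing an element of `gens` or
an inverse of one. -/
def TGConcat {β G : Type*} [Group G] (gen : β → G) (gens : Set G) : Prop :=
  ∀ w : List (β ⊕ β), IsGeodesic gen w → eval gen w ∈ Subgroup.closure gens →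
    ∃ ps : List (List (β ⊕ β)), w = ps.flatten ∧
      ∀ p ∈ ps, IsGeodesic gen p ∧ ∃ g ∈ gens, eval gen p = g ∨ eval gen p = g⁻¹

/-- Every freely reduced word in the elements `f j` and their inverses, read as a word over
`X^{±1}` (i.e. substituting geodesic representatives), is geodesic: the word length of the
element it represents is the sum of the word lengths of its letters. -/
def TGReducedGeodesic {β G κ : Type*} [Group G] (gen : β → G) (f : κ → G) : Prop :=
  ∀ l : List (κ ⊕ κ), FreelyReduced l →
    wlen gen (eval f l) =
      (l.map (Sum.elim (fun j => wlen gen (f j)) fun j => wlen gen (f j))).sum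

/-- The subgroup generated by the family `f` is totally geodesic in `(G, gen)`. -/
def TotallyGeodesicSub {β G κ : Type*} [Group G] (gen : β → G) (f : κ → G) : Prop :=
  TGConcat gen (Set.range f) ∧ TGReducedGeodesic gen f

/-- The data of a multiple HNN extension: a finitely generated base group
`A = ⟨X ∣ R⟩` and, for each stable letter `s_i` (`i ∈ Fin n`), words
`uw i j, vw i j` over `X` spelling the generators `u_{ij}` of `U_i` and
`v_{ij} = φ_i(u_{ij})` of `V_i`. -/
structure MHNNData where
  /-- the generating set of the base group -/
  X : Type
  /-- the generating set is finite -/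
  fin : Fintype X
  /-- the relators of the base group -/
  R : Set (FreeGroup X)
  /-- the number of stable letters -/
  n : ℕ
  /-- the number of free generators of each associated subgroup -/
  m : Fin n → ℕ
  /-- words spelling the free generators of the `U_i` -/
  uw : (i : Fin n) → Fin (m i) → FreeGroup X
  /-- words spelling the free generators of the `V_i` -/
  vw : (i : Fin n) → Fin (m i) → FreeGroup X

namespace MHNNData

variable (D : MHNNData)

/-- The base group `A = ⟨X ∣ R⟩`. -/
def A : Type := PresentedGroup D.R

instance : Group D.A := by unfold A; infer_instance

/-- The canonical projection `FreeGroup X → A`. -/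
def projA : FreeGroup D.X →* D.A := PresentedGroup.mk D.R

/-- The marking of the base group by its generators. -/
def genA : D.X → D.A := fun x => PresentedGroup.of x

/-- The free generators `u_{ij}` of the associated subgroup `U_i`. -/
def u (i : Fin D.n) (j : Fin (D.m i)) : D.A := D.projA (D.uw i j)

/-- The free generators `v_{ij} = φ_i(u_{ij})` of the associated subgroup `V_i`. -/
def v (i : Fin D.n) (j : Fin (D.m i)) : D.A := D.projA (D.vw i j)

/-- The associated subgroup `U_i`. -/
def U (i : Fin D.n) : Subgroup D.A := Subgroup.closure (Set.range (D.u i))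

/-- The associated subgroup `V_i`. -/
def V (i : Fin D.n) : Subgroup D.A := Subgroup.closure (Set.range (D.v i))

/-- The relators of the multiple HNN extension
`G = ⟨X, s_1, …, s_n ∣ R, s_i⁻¹ u_{ij} s_i = v_{ij}⟩`. -/
def relsG : Set (FreeGroup (D.X ⊕ Fin D.n)) :=
  FreeGroup.map Sum.inl '' D.R ∪
    { r | ∃ (i : Fin D.n) (j : Fin (D.m i)),
        r = (FreeGroup.of (Sum.inr i))⁻¹ * FreeGroup.map Sum.inl (D.uw i j) *
            FreeGroup.of (Sum.inr i) * (FreeGroup.map Sum.inl (D.vw i j))⁻¹ }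

/-- The multiple HNN extension `G`. -/
def G : Type := PresentedGroup D.relsG

instance : Group D.G := by unfold G; infer_instance

/-- The marking of `G` by the generating set `X ∪ {s_1, …, s_n}`. -/
def genG : D.X ⊕ Fin D.n → D.G := fun x => PresentedGroup.of x

/-- Each associated subgroup `U_i`, `V_i` is free with the given (finite) free basis:
the induced maps from the free group are injective. -/
def FreeBases : Prop :=
  ∀ i : Fin D.n,
    Function.Injective (FreeGroup.lift (D.u i) : FreeGroup (Fin (D.m i)) →* D.A) ∧
    Function.Injective (FreeGroup.lift (D.v i) : FreeGroup (Fin (D.m i)) →* D.A)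

/-- All associated subgroups are totally geodesic. -/
def TotallyGeodesic : Prop :=
  ∀ i : Fin D.n,
    TotallyGeodesicSub D.genA (D.u i) ∧ TotallyGeodesicSub D.genA (D.v i)

/-- The presentation is strip equidistant: `|u_{ij}| = |v_{ij}|` in `(A,X)`. -/
def StripEquidistant : Prop :=
  ∀ (i : Fin D.n) (j : Fin (D.m i)), wlen D.genA (D.u i j) = wlen D.genA (D.v i j)

/-- `G` is an isometric multiple HNN extension: the associated subgroups are finitely
generated free, totally geodesic, and strip equidistant. -/
def IsIsometric : Prop :=
  D.FreeBases ∧ D.TotallyGeodesic ∧ D.StripEquidistant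

end MHNNData


section WordLength

variable {β G : Type*} [Group G]

theorem eval_nil (gen : β → G) : eval gen [] = 1 := rfl

theorem eval_cons (gen : β → G) (x : β ⊕ β) (w : List (β ⊕ β)) :
    eval gen (x :: w) = letterEval gen x * eval gen w := by
  simp [eval]

theorem eval_append (gen : β → G) (w w' : List (β ⊕ β)) :
    eval gen (w ++ w') = eval gen w * eval gen w' := by
  simp [eval]

theorem letterEval_swap (gen : β → G) (x : β ⊕ β) :
    letterEval gen x.swap = (letterEval gen x)⁻¹ := by
  cases x <;> simp [letterEval]

theorem eval_reverse_swap (gen : β → G) (w : List (β ⊕ β)) :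
    eval gen (w.map Sum.swap).reverse = (eval gen w)⁻¹ := by
  induction w with
  | nil => simp [eval]
  | cons x w ih =>
    rw [List.map_cons, List.reverse_cons, eval_append, ih, eval_cons, eval_cons, eval_nil,
      letterEval_swap, mul_one, mul_inv_rev]

theorem wlen_eval_le (gen : β → G) (w : List (β ⊕ β)) : wlen gen (eval gen w) ≤ w.length :=
  Nat.sInf_le ⟨w, rfl, rfl⟩

theorem Generates.exists_eval_eq {gen : β → G} (h : Generates gen) (g : G) :
    ∃ w : List (β ⊕ β), eval gen w = g ∧ w.length = wlen gen g := by
  obtain ⟨w, hw⟩ := h g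
  exact Nat.sInf_mem (s := {n : ℕ | ∃ w : List (β ⊕ β), eval gen w = g ∧ w.length = n})
    ⟨w.length, w, hw, rfl⟩

theorem wlen_one (gen : β → G) : wlen gen 1 = 0 :=
  Nat.le_zero.1 (wlen_eval_le gen [])

theorem wlen_letterEval_le (gen : β → G) (x : β ⊕ β) : wlen gen (letterEval gen x) ≤ 1 := by
  simpa [eval_cons, eval_nil] using wlen_eval_le gen [x]

theorem wlen_mul_le {gen : β → G} (h : Generates gen) (a b : G) :
    wlen gen (a * b) ≤ wlen gen a + wlen gen b := by
  obtain ⟨w, rfl, hw⟩ := h.exists_eval_eq a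
  obtain ⟨w', rfl, hw'⟩ := h.exists_eval_eq b
  rw [← hw, ← hw', ← eval_append, ← List.length_append]
  exact wlen_eval_le gen _

theorem wlen_inv {gen : β → G} (h : Generates gen) (a : G) : wlen gen a⁻¹ = wlen gen a := by
  have key : ∀ a, wlen gen a⁻¹ ≤ wlen gen a := by
    intro a
    obtain ⟨w, rfl, hw⟩ := h.exists_eval_eq a
    rw [← hw, ← eval_reverse_swap]
    simpa using wlen_eval_le gen (w.map Sum.swap).reverse
  refine le_antisymm (key a) ?_
  simpa using key a⁻¹

/-- The range of the evaluation map is a subgroup, so a family whose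
subgroup closure is everything generates. -/
theorem generates_of_closure_range_eq_top {gen : β → G}
    (h : Subgroup.closure (Set.range gen) = ⊤) : Generates gen := by
  intro g
  have hg : g ∈ Subgroup.closure (Set.range gen) := h ▸ Subgroup.mem_top g
  induction hg using Subgroup.closure_induction with
  | mem x hx =>
    obtain ⟨b, rfl⟩ := hx
    exact ⟨[Sum.inl b], by simp [eval, letterEval]⟩
  | one => exact ⟨[], rfl⟩
  | mul x y _ _ hx hy =>
    obtain ⟨w, rfl⟩ := hx
    obtain ⟨w', rfl⟩ := hy
    exact ⟨w ++ w', eval_append _ _ _⟩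
  | inv x _ hx =>
    obtain ⟨w, rfl⟩ := hx
    exact ⟨_, eval_reverse_swap _ _⟩

/-- A letter of `FreeGroup.toWord` seen as a letter of the formal alphabet `κ^{±1}`. -/
def letterOfBool {κ : Type*} (p : κ × Bool) : κ ⊕ κ :=
  cond p.2 (Sum.inl p.1) (Sum.inr p.1)

theorem eval_map_letterOfBool {κ : Type*} (f : κ → G) (L : List (κ × Bool)) :
    eval f (L.map letterOfBool) = FreeGroup.lift f (FreeGroup.mk L) := by
  rw [FreeGroup.lift_mk, eval, List.map_map]
  congr 2
  funext p
  obtain ⟨k, _ | _⟩ := p <;> rfl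

theorem freelyReduced_map_letterOfBool {κ : Type*} {L : List (κ × Bool)}
    (h : FreeGroup.IsReduced L) : FreelyReduced (L.map letterOfBool) := by
  refine (List.isChain_map _).2 (h.imp ?_)
  rintro ⟨a, _ | _⟩ ⟨b, _ | _⟩ hab <;> simp_all [IsInvPair, letterOfBool]

/-- Two families with matching lengths, whose freely reduced words are geodesic, have lifts to
the free group of equal length. -/
theorem wlen_lift_eq {κ : Type*} {gen : β → G} {f f' : κ → G} (hf : TGReducedGeodesic gen f)
    (hf' : TGReducedGeodesic gen f') (hlen : ∀ j, wlen gen (f j) = wlen gen (f' j))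
    (x : FreeGroup κ) : wlen gen (FreeGroup.lift f x) = wlen gen (FreeGroup.lift f' x) := by
  classical
  have hred := freelyReduced_map_letterOfBool (FreeGroup.isReduced_toWord (x := x))
  have h := hf _ hred
  have h' := hf' _ hred
  rw [eval_map_letterOfBool, FreeGroup.mk_toWord] at h h'
  simp only [h, h', hlen]

end WordLength

section Extension

universe u

/-- Two maps with the same range become isomorphic over their target after multiplying their
sources by a large infinite type. -/
theorem exists_equiv_prod_of_range_eq {P P' K : Type u} {C : Type*} (f : P → C) (f' : P' → C)
    (hr : Set.range f = Set.range f') [Infinite K] (hP : Cardinal.mk P ≤ Cardinal.mk K)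
    (hP' : Cardinal.mk P' ≤ Cardinal.mk K) :
    ∃ σ : P × K ≃ P' × K, ∀ q, f' (σ q).1 = f q.1 := by
  have card : ∀ {Q : Type u} (h : Q → C) (c : C), Cardinal.mk Q ≤ Cardinal.mk K →
      c ∈ Set.range h → Cardinal.mk {q : Q × K // h q.1 = c} = Cardinal.mk K := by
    rintro Q h c hQ ⟨p, rfl⟩
    apply le_antisymm
    · refine (Cardinal.mk_subtype_le _).trans ?_
      rw [Cardinal.mk_prod, Cardinal.lift_id, Cardinal.lift_id]
      exact (mul_le_mul_left hQ _).trans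
        (Cardinal.mul_eq_self (Cardinal.aleph0_le_mk K)).le
    · exact Cardinal.mk_le_of_injective (f := fun k : K => ⟨(p, k), rfl⟩)
        fun k k' hk => by simpa using hk
  have hfib : ∀ c, Nonempty ({q : P × K // f q.1 = c} ≃ {q : P' × K // f' q.1 = c}) := by
    intro c
    by_cases hc : c ∈ Set.range f
    · exact Cardinal.eq.1 ((card f c hP hc).trans (card f' c hP' (hr ▸ hc)).symm)
    · have h1 : IsEmpty {q : P × K // f q.1 = c} := ⟨fun q => hc ⟨_, q.2⟩⟩
      have h2 : IsEmpty {q : P' × K // f' q.1 = c} := ⟨fun q => hc (hr ▸ ⟨_, q.2⟩)⟩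
      exact ⟨Equiv.equivOfIsEmpty _ _⟩
  let e := fun c => (hfib c).some
  exact ⟨Equiv.ofFiberEquiv (f := fun q : P × K => f q.1) (g := fun q : P' × K => f' q.1) e,
    fun q => Equiv.ofFiberEquiv_map e q⟩

/-- An injective homomorphism makes the target a free left module over the source, with a basis
of coset representatives. -/
theorem exists_transversal_equiv {F A : Type*} [Group F] [Group A] (α : F →* A)
    (hα : Function.Injective α) :
    ∃ (T : Set A) (e : F × T ≃ A), ∀ x t, e (x, t) = α x * t := by
  obtain ⟨T, hT, -⟩ := α.range.exists_isComplement_right 1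
  exact ⟨T, ((MonoidHom.ofInjective hα).toEquiv.prodCongr (Equiv.refl T)).trans
    (Equiv.ofBijective _ hT), fun x t => rfl⟩

variable {β : Type*} {A : Type u} [Group A]

/-- Integer-valued functions which are 1-Lipschitz for the right-invariant word metric. -/
def LipFun (gen : β → A) : Type u :=
  {g : A → ℤ // ∀ a b, g a ≤ g b + wlen gen (a * b⁻¹)}

/-- The word length as a 1-Lipschitz function. -/
noncomputable def wlenLip {gen : β → A} (hgen : Generates gen) : LipFun gen :=
  ⟨fun a => wlen gen a, fun a b => by
    have := wlen_mul_le hgen (a * b⁻¹) b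
    rw [inv_mul_cancel_right] at this
    simp only
    omega⟩

/-- McShane extension: a function on an injective image of `F`, translated by `t`, that is
1-Lipschitz extends to a 1-Lipschitz function. -/
theorem exists_lipFun_extension {F : Type*} [Group F] {gen : β → A} (hgen : Generates gen)
    (α : F →* A) (t : A) (h : F → ℤ) (hh : ∀ x y, h x ≤ h y + wlen gen (α (x * y⁻¹))) :
    ∃ g : LipFun gen, ∀ x, g.1 (α x * t) = h x := by
  have bdd : ∀ a : A, BddBelow (Set.range fun x => h x + wlen gen (a * (α x * t)⁻¹)) := by
    intro a
    refine ⟨h 1 - wlen gen (a * t⁻¹), ?_⟩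
    rintro _ ⟨x, rfl⟩
    have h1 := hh 1 x
    have h2 := wlen_mul_le hgen (a * t⁻¹)⁻¹ (a * (α x * t)⁻¹)
    rw [wlen_inv hgen] at h2
    have h3 : (a * t⁻¹)⁻¹ * (a * (α x * t)⁻¹) = α (1 * x⁻¹) := by
      simp only [map_mul, map_one, map_inv]; group
    rw [h3] at h2
    beta_reduce
    omega
  refine ⟨⟨fun a => ⨅ x, (h x + wlen gen (a * (α x * t)⁻¹)), fun a b => ?_⟩, fun y => ?_⟩
  · rw [← sub_le_iff_le_add]
    refine le_ciInf fun x => ?_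
    have h1 := ciInf_le (bdd a) x
    have h2 := wlen_mul_le hgen (a * b⁻¹) (b * (α x * t)⁻¹)
    rw [← mul_assoc, inv_mul_cancel_right] at h2
    beta_reduce at h1 ⊢
    omega
  · refine le_antisymm ((ciInf_le (bdd _) y).trans ?_) (le_ciInf fun x => ?_)
    · simp [wlen_one]
    · have h1 := hh y x
      have h3 : α y * t * (α x * t)⁻¹ = α (y * x⁻¹) := by
        simp only [map_mul, map_inv]; group
      rwa [h3]

/-- A large disjoint union of copies of `A`, indexed by the 1-Lipschitz functions on `A`. -/
abbrev LipSpace (gen : β → A) : Type u := LipFun gen × A × (LipFun gen × A × ℕ)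

/-- The height function on `LipSpace`, given on each copy of `A` by its index. -/
def height {gen : β → A} (ω : LipSpace gen) : ℤ := ω.1.1 ω.2.1

/-- The action of `A` on `LipSpace` by left multiplication on each copy. -/
def translate (gen : β → A) : A →* Equiv.Perm (LipSpace gen) where
  toFun a := (Equiv.refl _).prodCongr ((Equiv.mulLeft a).prodCongr (Equiv.refl _))
  map_one' := by ext ω : 1; simp
  map_mul' a b := by
    ext ω : 1
    exact Prod.ext rfl (Prod.ext (mul_assoc _ _ _) rfl)

theorem translate_apply (gen : β → A) (a : A) (ω : LipSpace gen) :
    translate gen a ω = (ω.1, a * ω.2.1, ω.2.2) := rfl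

theorem height_translate_le {gen : β → A} (a : A) (ω : LipSpace gen) :
    height (translate gen a ω) ≤ height ω + wlen gen a := by
  have h := ω.1.2 (a * ω.2.1) ω.2.1
  rwa [mul_inv_cancel_right] at h

/-- A pair of injective homomorphisms which agree in length is intertwined by a
height-preserving permutation of `LipSpace`. -/
theorem exists_intertwining_perm {F : Type*} [Group F] {gen : β → A} (hgen : Generates gen)
    (α α' : F →* A) (hα : Function.Injective α) (hα' : Function.Injective α')
    (hlen : ∀ x, wlen gen (α x) = wlen gen (α' x)) :
    ∃ s : Equiv.Perm (LipSpace gen), (∀ ω, height (s ω) = height ω) ∧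
      ∀ x, translate gen (α x) * s = s * translate gen (α' x) := by
  have : Nonempty (LipFun gen) := ⟨wlenLip hgen⟩
  obtain ⟨T, e, he⟩ := exists_transversal_equiv α hα
  obtain ⟨T', e', he'⟩ := exists_transversal_equiv α' hα'
  have hT : Nonempty T := ⟨(e.symm 1).2⟩
  have hT' : Nonempty T' := ⟨(e'.symm 1).2⟩
  have range_eq : ∀ (α : F →* A) (T : Set A), Nonempty T →
      Set.range (fun (p : LipFun gen × T) (x : F) => p.1.1 (α x * p.2)) =
        {h : F → ℤ | ∀ x y, h x ≤ h y + wlen gen (α (x * y⁻¹))} := by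
    rintro α T ⟨t⟩
    ext h
    constructor
    · rintro ⟨p, rfl⟩ x y
      have h1 := p.1.2 (α x * p.2) (α y * p.2)
      have h3 : α x * p.2 * (α y * p.2)⁻¹ = α (x * y⁻¹) := by
        simp only [map_mul, map_inv]; group
      rwa [h3] at h1
    · intro hh
      obtain ⟨g, hg⟩ := exists_lipFun_extension hgen α t h hh
      exact ⟨(g, t), funext hg⟩
  have card_le : ∀ T : Set A,
      Cardinal.mk (LipFun gen × T) ≤ Cardinal.mk (LipFun gen × A × ℕ) := fun T =>
    Cardinal.mk_le_of_injective (f := fun p => (p.1, (p.2 : A), 0))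
      fun p q h => by
        simp only [Prod.mk.injEq, and_true] at h
        exact Prod.ext h.1 (Subtype.ext h.2)
  obtain ⟨σ, hσ⟩ := exists_equiv_prod_of_range_eq
    (fun (p : LipFun gen × T') (x : F) => p.1.1 (α' x * p.2))
    (fun (p : LipFun gen × T) (x : F) => p.1.1 (α x * p.2))
    (by rw [range_eq α T hT, range_eq α' T' hT']; simp only [hlen])
    (card_le T') (card_le T)
  -- regroup a copy of `A` as a union of `F`-orbits
  let regroup (T : Set A) (e : F × T ≃ A) :
      F × ((LipFun gen × T) × (LipFun gen × A × ℕ)) ≃ LipSpace gen :=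
    { toFun := fun q => (q.2.1.1, e (q.1, q.2.1.2), q.2.2)
      invFun := fun ω => ((e.symm ω.2.1).1, (ω.1, (e.symm ω.2.1).2), ω.2.2)
      left_inv := fun q => by simp
      right_inv := fun ω => by simp }
  have regroup_smul : ∀ (α : F →* A) (T : Set A) (e : F × T ≃ A)
      (_ : ∀ x t, e (x, t) = α x * t) (x y q),
      translate gen (α x) (regroup T e (y, q)) = regroup T e (x * y, q) := by
    intro α T e he x y q
    simp [regroup, translate_apply, he, mul_assoc]
  let s : Equiv.Perm (LipSpace gen) :=
    (regroup T' e').symm.trans (((Equiv.refl F).prodCongr σ).trans (regroup T e))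
  have hs : ∀ y q, s (regroup T' e' (y, q)) = regroup T e (y, σ q) := fun y q => by simp [s]
  refine ⟨s, fun ω => ?_, fun x => Equiv.ext fun ω => ?_⟩
  · obtain ⟨⟨y, q⟩, rfl⟩ := (regroup T' e').surjective ω
    rw [hs]
    simpa [height, regroup, he, he'] using congrFun (hσ q) y
  · obtain ⟨⟨y, q⟩, rfl⟩ := (regroup T' e').surjective ω
    rw [Equiv.Perm.mul_apply, Equiv.Perm.mul_apply, regroup_smul α' T' e' he', hs, hs,
      regroup_smul α T e he]

end Extension

namespace MHNNData

variable (D : MHNNData)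

theorem generates_genA : Generates D.genA :=
  generates_of_closure_range_eq_top (PresentedGroup.closure_range_of D.R)

theorem generates_genG : Generates D.genG :=
  generates_of_closure_range_eq_top (PresentedGroup.closure_range_of D.relsG)

/-- Homomorphisms out of the base group are determined on the generators. -/
theorem hom_ext_A {H : Type*} [Group H] {f g : D.A →* H}
    (h : ∀ x, f (D.genA x) = g (D.genA x)) : f = g :=
  PresentedGroup.ext (rels := D.R) h

/-- Universal property of the multiple HNN extension. -/
theorem exists_hom_G {H : Type*} [Group H] (f : D.A →* H) (s : Fin D.n → H)
    (hs : ∀ i j, f (D.u i j) * s i = s i * f (D.v i j)) :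
    ∃ Φ : D.G →* H, (∀ x, Φ (D.genG (Sum.inl x)) = f (D.genA x)) ∧
      ∀ i, Φ (D.genG (Sum.inr i)) = s i := by
  let k : D.X ⊕ Fin D.n → H := Sum.elim (fun x => f (D.genA x)) s
  have hk : ∀ w, FreeGroup.lift k (FreeGroup.map Sum.inl w) = f (D.projA w) := by
    intro w
    have : (FreeGroup.lift k).comp (FreeGroup.map Sum.inl) = f.comp D.projA := by
      ext x
      simp only [MonoidHom.comp_apply, FreeGroup.map.of, FreeGroup.lift_apply_of]
      rfl
    exact DFunLike.congr_fun this w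
  have hrel : ∀ r ∈ D.relsG, FreeGroup.lift k r = 1 := by
    rintro r (⟨w, hw, rfl⟩ | ⟨i, j, rfl⟩)
    · rw [hk, show D.projA w = 1 from PresentedGroup.one_of_mem hw, map_one]
    · have h := hs i j
      simp only [map_mul, map_inv, hk, FreeGroup.lift_apply_of]
      change (s i)⁻¹ * f (D.u i j) * s i * (f (D.v i j))⁻¹ = 1
      rw [mul_assoc (s i)⁻¹, h]
      group
  exact ⟨PresentedGroup.toGroup hrel, fun x => PresentedGroup.toGroup.of hrel,
    fun i => PresentedGroup.toGroup.of hrel⟩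

end MHNNData

open MHNNData in
/-- In an isometric multiple HNN extension of a finitely presented base
group, the natural inclusion `ι : A → G` (the homomorphism sending each generator `x ∈ X`
of `A` to the corresponding generator of `G`) is an isometric embedding of word metrics;
in particular it maps the sphere (resp. ball) of radius `N` of `(A,X)` into the sphere
(resp. ball) of radius `N` of `(G, X ∪ {s_1,…,s_n})`. -/
theorem isometric_mhnn_base_isometrically_embedded (D : MHNNData) (hfp : D.R.Finite)
    (hiso : D.IsIsometric)
    (ι : D.A →* D.G) (hι : ∀ x : D.X, ι (D.genA x) = D.genG (Sum.inl x)) :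
    (∀ a : D.A, wlen D.genG (ι a) = wlen D.genA a) ∧
    (∀ (N : ℕ) (a : D.A), wlen D.genA a = N → wlen D.genG (ι a) = N) ∧
    (∀ (N : ℕ) (a : D.A), wlen D.genA a ≤ N → wlen D.genG (ι a) ≤ N) := by
  have key : ∀ a : D.A, wlen D.genG (ι a) = wlen D.genA a := by
    intro a
    apply le_antisymm
    · obtain ⟨w, rfl, hw⟩ := D.generates_genA.exists_eval_eq a
      have : ι (eval D.genA w) = eval D.genG (w.map (Sum.map Sum.inl Sum.inl)) := by
        rw [eval, eval, map_list_prod, List.map_map, List.map_map]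
        congr 2
        funext x
        cases x <;> simp [letterEval, hι]
      rw [← hw, this]
      simpa using wlen_eval_le D.genG (w.map (Sum.map Sum.inl Sum.inl))
    · obtain ⟨hfree, htg, heq⟩ := hiso
      choose s hs hsu using fun i => exists_intertwining_perm D.generates_genA
        (FreeGroup.lift (D.u i)) (FreeGroup.lift (D.v i)) (hfree i).1 (hfree i).2
        (wlen_lift_eq (htg i).1.2 (htg i).2.2 (heq i))
      obtain ⟨Φ, hΦx, hΦs⟩ := D.exists_hom_G (translate D.genA) s fun i j => by
        simpa using hsu i (FreeGroup.of j)
      have hΦι : Φ.comp ι = translate D.genA := D.hom_ext_A fun x => by simp [hι, hΦx]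
      have hletter : ∀ x ω, height (Φ (letterEval D.genG x) ω) ≤ height ω + 1 := by
        have htr : ∀ x ω,
            height (translate D.genA (letterEval D.genA x) ω) ≤ height ω + 1 := by
          intro x ω
          have h1 := height_translate_le (letterEval D.genA x) ω
          have h2 := wlen_letterEval_le D.genA x
          omega
        rintro ((x | i) | (x | i)) ω
        · simpa [letterEval, hΦx] using htr (Sum.inl x) ω
        · simp [letterEval, hΦs, hs]
        · simpa [letterEval, hΦx] using htr (Sum.inr x) ω
        · have h := hs i ((s i)⁻¹ ω)
          rw [← Equiv.Perm.mul_apply, mul_inv_cancel, Equiv.Perm.one_apply] at h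
          simp [letterEval, hΦs, h]
      have hword : ∀ w ω, height (Φ (eval D.genG w) ω) ≤ height ω + w.length := by
        intro w ω
        induction w with
        | nil => simp [eval_nil]
        | cons x w ih =>
          rw [eval_cons, map_mul, Equiv.Perm.mul_apply, List.length_cons]
          have := hletter x (Φ (eval D.genG w) ω)
          push_cast
          omega
      obtain ⟨w, hw, hlen⟩ := D.generates_genG.exists_eval_eq (ι a)
      have h := hword w
        (wlenLip D.generates_genA, 1, (wlenLip D.generates_genA, 1, 0))
      rw [hw, ← MonoidHom.comp_apply, hΦι, translate_apply] at h
      simp only [height, wlenLip, mul_one, wlen_one] at h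
      omega
  exact ⟨key, fun N a h => (key a).trans h, fun N a h => (key a).le.trans h⟩

end ACPaper
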